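/- arXiv:2205.01773 — 2 statements merged into one kernel-verified Lean document; each statement's English description precedes it below -/
import Mathlib

section
/- Let X be a random vector valued in ℝ^m with ‖X‖₂ ≤ 1 almost surely. Let S = E[X X^T], let t ≥ 1 be an integer, and let P be the orthogonal projection onto the subspace spanned by eigenvectors of S corresponding to its t largest eigenvalues. Let Y = E[X | P X]. Then ‖Σ_X − Σ_Y‖_F = ‖E[X X^T] − E[Y Y^T]‖_F ≤ 1/√t. -/
open MeasureTheory ProbabilityTheory Real Finset

/-- The covariance matrix `Σ_X = 𝔼[(X - 𝔼X)(X - 𝔼X)ᵀ]` of a random vector `X`. -/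
noncomputable def covMatrix {Ω : Type*} [MeasurableSpace Ω] (μ : Measure Ω) {m : ℕ}
    (X : Ω → Fin m → ℝ) : Matrix (Fin m) (Fin m) ℝ :=
  Matrix.of fun i j =>
    ∫ ω, (X ω i - ∫ ω', X ω' i ∂μ) * (X ω j - ∫ ω', X ω' j ∂μ) ∂μ

/-- The Frobenius norm `‖A‖_F = √(∑ i j, A i j ^ 2)`. -/
noncomputable def frobNorm {m : ℕ} (A : Matrix (Fin m) (Fin m) ℝ) : ℝ :=
  Real.sqrt (∑ i, ∑ j, (A i j) ^ 2)

/-- Pulling out the conditional expectation. -/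
lemma pca_pull {Ω : Type} (M : MeasurableSpace Ω) {m0 : MeasurableSpace Ω} (μ : Measure Ω)
    [IsProbabilityMeasure μ] (hM : M ≤ m0) (f g : Ω → ℝ) (hf : MemLp f 2 μ) (hg : MemLp g 2 μ) :
    ∫ ω, f ω * (μ[g | M]) ω ∂μ = ∫ ω, (μ[f | M]) ω * (μ[g | M]) ω ∂μ := by
  have hg' : MemLp (μ[g | M]) 2 μ := hg.condExp one_le_two
  have h := condExp_mul_of_stronglyMeasurable_right (μ := μ) (m := M) (f := f) (g := μ[g | M])
    stronglyMeasurable_condExp (hf.integrable_mul hg') (hf.integrable one_le_two)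
  have h2 := integral_condExp (μ := μ) (f := f * μ[g | M]) hM
  rw [integral_congr_ae h] at h2
  exact h2.symm

/-- The deterministic core: spectral bound on vectors orthogonal to the top eigenvectors. -/
lemma pca_spectral (m : ℕ) (S : Matrix (Fin m) (Fin m) ℝ)
    (u : Fin m → Fin m → ℝ) (d : Fin m → ℝ)
    (hortho : ∀ i j, (∑ l, u i l * u j l) = if i = j then 1 else 0)
    (heig : ∀ i, S.mulVec (u i) = d i • u i)
    (hsorted : ∀ i j : Fin m, i ≤ j → d j ≤ d i)
    (hpos : ∀ v : Fin m → ℝ, 0 ≤ ∑ i, ∑ j, S i j * v i * v j)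
    (htr : ∑ i, S i i ≤ 1)
    (t : ℕ) (ht : 1 ≤ t) (v : Fin m → ℝ)
    (hv : ∀ k : Fin m, (k : ℕ) < t → ∑ l, u k l * v l = 0) :
    ∑ i, ∑ j, S i j * v i * v j ≤ (1 / t) * ∑ i, v i ^ 2 := by
  have htp : (0 : ℝ) < t := by exact_mod_cast ht
  have hcomp : ∀ a b, ∑ k, u k a * u k b = if a = b then 1 else 0 := by
    have h1 : (Matrix.of u) * (Matrix.of u).transpose = 1 := by
      ext i j
      simp [Matrix.mul_apply, hortho, Matrix.one_apply]
    have h2 := mul_eq_one_comm.mp h1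
    intro a b
    have := congrFun (congrFun h2 a) b
    simpa [Matrix.mul_apply, Matrix.one_apply] using this
  have heig' : ∀ k i, ∑ j, S i j * u k j = d k * u k i := by
    intro k i
    have := congrFun (heig k) i
    simpa [Matrix.mulVec, dotProduct] using this
  have hSd : ∀ i j, S i j = ∑ k, d k * u k i * u k j := by
    intro i j
    simp_rw [← heig', Finset.sum_mul]
    rw [Finset.sum_comm]
    simp_rw [mul_assoc, ← Finset.mul_sum, hcomp]
    simp
  have hquad : ∀ w : Fin m → ℝ,
      ∑ i, ∑ j, S i j * w i * w j = ∑ k, d k * (∑ l, u k l * w l) ^ 2 := by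
    intro w
    have : ∀ k, d k * (∑ l, u k l * w l) ^ 2
        = ∑ i, ∑ j, d k * u k i * u k j * w i * w j := by
      intro k
      rw [sq, Finset.sum_mul_sum, Finset.mul_sum]
      refine Finset.sum_congr rfl fun i _ => ?_
      rw [Finset.mul_sum]
      refine Finset.sum_congr rfl fun j _ => ?_
      ring
    simp_rw [this, hSd, Finset.sum_mul]
    rw [Finset.sum_comm' (t' := Finset.univ) (s' := fun _ => Finset.univ) (by simp)]
    rw [Finset.sum_comm]
    conv_lhs =>
      enter [2, i]
      rw [Finset.sum_comm]
    rw [Finset.sum_comm]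
  have hnorm : ∑ k, (∑ l, u k l * v l) ^ 2 = ∑ i, v i ^ 2 := by
    have : ∀ k, (∑ l, u k l * v l) ^ 2 = ∑ i, ∑ j, u k i * u k j * (v i * v j) := by
      intro k
      rw [sq, Finset.sum_mul_sum]
      refine Finset.sum_congr rfl fun i _ => ?_
      refine Finset.sum_congr rfl fun j _ => ?_
      ring
    simp_rw [this]
    rw [Finset.sum_comm]
    conv_lhs =>
      enter [2, i]
      rw [Finset.sum_comm]
    simp_rw [← Finset.sum_mul, hcomp]
    simp [sq]
  have hdpos : ∀ k, 0 ≤ d k := by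
    intro k
    have := hpos (u k)
    rw [hquad] at this
    simpa [hortho] using this
  have hdsum : ∑ k, d k ≤ 1 := by
    have : ∑ i, S i i = ∑ k, d k := by
      simp_rw [hSd]
      rw [Finset.sum_comm]
      simp_rw [mul_assoc, ← Finset.mul_sum, hortho]
      simp
    rwa [this] at htr
  have hdk : ∀ k : Fin m, t ≤ (k : ℕ) → d k ≤ 1 / t := by
    intro k hk
    rw [le_div_iff₀ htp]
    have hc : (Finset.univ.filter (fun i : Fin m => (i : ℕ) < t)).card = t := by
      rw [Fin.card_filter_val_lt]
      have := k.2
      omega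
    have h1 : (t : ℝ) * d k ≤ ∑ i ∈ Finset.univ.filter (fun i : Fin m => (i : ℕ) < t), d i := by
      have := Finset.card_nsmul_le_sum (Finset.univ.filter (fun i : Fin m => (i : ℕ) < t)) d (d k)
        (fun i hi => hsorted i k (by
          have := (Finset.mem_filter.mp hi).2
          exact Fin.le_def.mpr (by omega)))
      rwa [hc, nsmul_eq_mul] at this
    have h2 : ∑ i ∈ Finset.univ.filter (fun i : Fin m => (i : ℕ) < t), d i ≤ ∑ i, d i :=
      Finset.sum_le_sum_of_subset_of_nonneg (Finset.filter_subset _ _) (fun i _ _ => hdpos i)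
    linarith
  rw [hquad, ← hnorm, Finset.mul_sum]
  refine Finset.sum_le_sum fun k _ => ?_
  by_cases hk : (k : ℕ) < t
  · simp [hv k hk]
  · exact mul_le_mul_of_nonneg_right (hdk k (not_lt.mp hk)) (sq_nonneg _)

lemma pca_cov {Ω : Type} [MeasurableSpace Ω] (μ : Measure Ω) [IsProbabilityMeasure μ]
    {m : ℕ} (X : Ω → Fin m → ℝ) (hX : ∀ i, MemLp (fun ω => X ω i) 2 μ) (i j : Fin m) :
    covMatrix μ X i j = ∫ ω, X ω i * X ω j ∂μ - (∫ ω, X ω i ∂μ) * ∫ ω, X ω j ∂μ := by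
  have := covariance_eq_sub (hX i) (hX j)
  simpa [covariance, covMatrix] using this

/-- `𝔼 (v ⬝ W)²` as a quadratic form. -/
lemma pca_quad {Ω : Type} [MeasurableSpace Ω] (μ : Measure Ω) [IsProbabilityMeasure μ]
    {m : ℕ} (W : Ω → Fin m → ℝ) (hW : ∀ i, MemLp (fun ω => W ω i) 2 μ) (v : Fin m → ℝ) :
    0 ≤ ∑ i, ∑ j, (∫ ω, W ω i * W ω j ∂μ) * v i * v j := by
  have hint : ∀ i j, Integrable (fun ω => W ω i * W ω j) μ :=
    fun i j => (hW i).integrable_mul (hW j)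
  have : ∑ i, ∑ j, (∫ ω, W ω i * W ω j ∂μ) * v i * v j
      = ∫ ω, (∑ i, W ω i * v i) ^ 2 ∂μ := by
    have h : ∀ ω, (∑ i, W ω i * v i) ^ 2 = ∑ i, ∑ j, (W ω i * W ω j) * v i * v j := by
      intro ω
      rw [sq, Finset.sum_mul_sum]
      refine Finset.sum_congr rfl fun i _ => ?_
      refine Finset.sum_congr rfl fun j _ => ?_
      ring
    simp_rw [h]
    rw [integral_finsetSum _ (fun i _ => integrable_finsetSum _
      (fun j _ => ((hint i j).mul_const _).mul_const _))]
    refine Finset.sum_congr rfl fun i _ => ?_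
    rw [integral_finsetSum _ (fun j _ => ((hint i j).mul_const _).mul_const _)]
    refine Finset.sum_congr rfl fun j _ => ?_
    rw [integral_mul_const, integral_mul_const]
  rw [this]
  exact integral_nonneg fun ω => sq_nonneg _

theorem pca_core
    (Ω : Type) (M : MeasurableSpace Ω) [m0 : MeasurableSpace Ω] (hM : M ≤ m0) (μ : Measure Ω) [IsProbabilityMeasure μ]
    (m : ℕ) (X : Ω → Fin m → ℝ) (hXmeas : Measurable X)
    (hXnorm : ∀ᵐ ω ∂μ, Real.sqrt (∑ i, X ω i ^ 2) ≤ 1)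
    (S : Matrix (Fin m) (Fin m) ℝ)
    (hS : S = Matrix.of fun i j => ∫ ω, X ω i * X ω j ∂μ)
    (u : Fin m → Fin m → ℝ) (d : Fin m → ℝ)
    (hortho : ∀ i j, (∑ l, u i l * u j l) = if i = j then 1 else 0)
    (heig : ∀ i, S.mulVec (u i) = d i • u i)
    (hsorted : ∀ i j : Fin m, i ≤ j → d j ≤ d i)
    (t : ℕ) (ht : 1 ≤ t)
    (hMsm : ∀ k : Fin m, (k : ℕ) < t → StronglyMeasurable[M] (fun ω => ∑ l, u k l * X ω l))
    (Y : Ω → Fin m → ℝ)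
    (hY : Y = fun ω i => (μ[fun ω' => X ω' i | M]) ω) :
    frobNorm (covMatrix μ X - covMatrix μ Y) =
        frobNorm ((Matrix.of fun i j => ∫ ω, X ω i * X ω j ∂μ) -
          (Matrix.of fun i j => ∫ ω, Y ω i * Y ω j ∂μ)) ∧
      frobNorm (covMatrix μ X - covMatrix μ Y) ≤ 1 / Real.sqrt t := by
  have hXm : ∀ i, Measurable (fun ω => X ω i) := fun i => (measurable_pi_apply i).comp hXmeas
  have hsq : ∀ᵐ ω ∂μ, ∑ i, X ω i ^ 2 ≤ 1 := by
    filter_upwards [hXnorm] with ω h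
    exact Real.sqrt_le_one.mp h
  have hX2 : ∀ i, MemLp (fun ω => X ω i) 2 μ := by
    intro i
    refine MemLp.of_bound (hXm i).aestronglyMeasurable 1 ?_
    filter_upwards [hsq] with ω h
    have h1 : X ω i ^ 2 ≤ ∑ i, X ω i ^ 2 :=
      Finset.single_le_sum (f := fun i => X ω i ^ 2) (fun j _ => sq_nonneg _) (Finset.mem_univ i)
    rw [Real.norm_eq_abs]
    exact (sq_le_one_iff_abs_le_one _).mp (h1.trans h)
  have hYi : ∀ i, (fun ω => Y ω i) = μ[fun ω' => X ω' i | M] := by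
    intro i
    rw [hY]
  have hY2 : ∀ i, MemLp (fun ω => Y ω i) 2 μ := by
    intro i
    rw [hYi]
    exact (hX2 i).condExp one_le_two
  have hEY : ∀ i, ∫ ω, Y ω i ∂μ = ∫ ω, X ω i ∂μ := by
    intro i
    rw [hYi i]
    exact integral_condExp hM
  have hXY : ∀ i j, ∫ ω, X ω i * Y ω j ∂μ = ∫ ω, Y ω i * Y ω j ∂μ := by
    intro i j
    have := pca_pull M μ hM _ _ (hX2 i) (hX2 j)
    simp only [← hYi] at this
    exact this
  have hmat : covMatrix μ X - covMatrix μ Y = (Matrix.of fun i j => ∫ ω, X ω i * X ω j ∂μ) -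
          (Matrix.of fun i j => ∫ ω, Y ω i * Y ω j ∂μ) := by
    ext i j
    simp only [Matrix.sub_apply, pca_cov μ X hX2, pca_cov μ Y hY2, hEY, Matrix.of_apply]
    ring
  rw [hmat]
  refine ⟨rfl, ?_⟩
  have htp : (0 : ℝ) < t := by exact_mod_cast ht
  -- the residual
  set Z : Ω → Fin m → ℝ := fun ω i => X ω i - Y ω i with hZ
  have hZ2 : ∀ i, MemLp (fun ω => Z ω i) 2 μ := fun i => (hX2 i).sub (hY2 i)
  have hintZ : ∀ i j, Integrable (fun ω => Z ω i * Z ω j) μ :=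
    fun i j => (hZ2 i).integrable_mul (hZ2 j)
  set D : Matrix (Fin m) (Fin m) ℝ := (Matrix.of fun i j => ∫ ω, X ω i * X ω j ∂μ) -
          (Matrix.of fun i j => ∫ ω, Y ω i * Y ω j ∂μ) with hD
  have hDZ : ∀ i j, D i j = ∫ ω, Z ω i * Z ω j ∂μ := by
    intro i j
    have e : ∀ ω, Z ω i * Z ω j
        = (X ω i * X ω j - X ω i * Y ω j) - (X ω j * Y ω i - Y ω i * Y ω j) := by
      intro ω
      simp only [hZ]
      ring
    have i1 : Integrable (fun ω => X ω i * X ω j) μ := (hX2 i).integrable_mul (hX2 j)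
    have i2 : Integrable (fun ω => X ω i * Y ω j) μ := (hX2 i).integrable_mul (hY2 j)
    have i3 : Integrable (fun ω => X ω j * Y ω i) μ := (hX2 j).integrable_mul (hY2 i)
    have i4 : Integrable (fun ω => Y ω i * Y ω j) μ := (hY2 i).integrable_mul (hY2 j)
    have hc : ∫ ω, Y ω j * Y ω i ∂μ = ∫ ω, Y ω i * Y ω j ∂μ := by simp_rw [mul_comm]
    have i5 : Integrable (fun ω => X ω i * X ω j - X ω i * Y ω j) μ := i1.sub i2
    have i6 : Integrable (fun ω => X ω j * Y ω i - Y ω i * Y ω j) μ := i3.sub i4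
    simp_rw [e]
    rw [integral_sub i5 i6, integral_sub i1 i2, integral_sub i3 i4, hXY, hXY, hc]
    simp [hD]
  have htr : ∑ i, S i i ≤ 1 := by
    have : ∑ i, S i i = ∫ ω, ∑ i, X ω i ^ 2 ∂μ := by
      rw [integral_finsetSum _ (fun i _ => (hX2 i).integrable_sq)]
      simp [hS, sq]
    rw [this]
    calc ∫ ω, ∑ i, X ω i ^ 2 ∂μ ≤ ∫ _, (1 : ℝ) ∂μ :=
          integral_mono_ae (integrable_finsetSum _ (fun i _ => (hX2 i).integrable_sq))
            (integrable_const _) hsq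
      _ = 1 := by simp
  -- the residual is orthogonal to the top eigenvectors
  have hZorth : ∀ k : Fin m, (k : ℕ) < t → ∀ᵐ ω ∂μ, ∑ l, u k l * Z ω l = 0 := by
    intro k hk
    have hsm := hMsm k hk
    have hint : Integrable (fun ω => ∑ l, u k l * X ω l) μ :=
      integrable_finsetSum _ (fun l _ => ((hX2 l).integrable one_le_two).const_mul _)
    have h1 := condExp_of_stronglyMeasurable hM hsm hint
    have h2 := condExp_finsetSum (μ := μ) (s := Finset.univ) (f := fun l ω => u k l * X ω l)
      (fun l _ => ((hX2 l).integrable one_le_two).const_mul (u k l)) M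
    have h3 : ∀ᵐ ω ∂μ, ∀ l, (μ[fun ω => u k l * X ω l | M]) ω = u k l * Y ω l := by
      rw [ae_all_iff]
      intro l
      have := condExp_smul (μ := μ) (u k l) (fun ω => X ω l) M
      rw [← hYi l] at this
      filter_upwards [this] with ω hω
      exact hω
    have e2 : (∑ l, fun ω => u k l * X ω l) = fun ω => ∑ l, u k l * X ω l := by
      funext ω
      simp
    rw [e2, h1] at h2
    filter_upwards [h2, h3] with ω a b
    simp only [hZ, mul_sub, Finset.sum_sub_distrib]
    rw [a]
    simp [b]
  have hZall : ∀ᵐ ω ∂μ, ∀ k : Fin m, (k : ℕ) < t → ∑ l, u k l * Z ω l = 0 := by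
    rw [ae_all_iff]
    intro k
    by_cases hk : (k : ℕ) < t
    · filter_upwards [hZorth k hk] with ω h _
      exact h
    · exact Filter.Eventually.of_forall fun ω h => absurd h hk
  have hpos : ∀ v : Fin m → ℝ, 0 ≤ ∑ i, ∑ j, S i j * v i * v j := by
    intro v
    rw [hS]
    exact pca_quad μ X hX2 v
  have hDS : ∀ v : Fin m → ℝ, ∑ i, ∑ j, D i j * v i * v j ≤ ∑ i, ∑ j, S i j * v i * v j := by
    intro v
    have := pca_quad μ Y hY2 v
    have e : ∑ i, ∑ j, D i j * v i * v j = ∑ i, ∑ j, S i j * v i * v j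
        - ∑ i, ∑ j, (∫ ω, Y ω i * Y ω j ∂μ) * v i * v j := by
      rw [← Finset.sum_sub_distrib]
      refine Finset.sum_congr rfl fun i _ => ?_
      rw [← Finset.sum_sub_distrib]
      refine Finset.sum_congr rfl fun j _ => ?_
      simp only [hD, hS, Matrix.sub_apply, Matrix.of_apply]
      ring
    linarith
  have hpt : ∀ᵐ ω ∂μ, ∑ i, ∑ j, D i j * Z ω i * Z ω j ≤ (1 / t) * ∑ i, Z ω i ^ 2 := by
    filter_upwards [hZall] with ω h
    exact (hDS _).trans (pca_spectral m S u d hortho heig hsorted hpos htr t ht (Z ω) h)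
  have hF : ∑ i, ∑ j, (D i j) ^ 2 = ∫ ω, ∑ i, ∑ j, D i j * Z ω i * Z ω j ∂μ := by
    simp_rw [mul_assoc]
    rw [integral_finsetSum _ (fun i _ => integrable_finsetSum _
      (fun j _ => (hintZ i j).const_mul (D i j)))]
    refine Finset.sum_congr rfl fun i _ => ?_
    rw [integral_finsetSum _ (fun j _ => (hintZ i j).const_mul (D i j))]
    refine Finset.sum_congr rfl fun j _ => ?_
    rw [integral_const_mul, ← hDZ, sq]
  have hEZ : ∫ ω, ∑ i, Z ω i ^ 2 ∂μ ≤ 1 := by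
    rw [integral_finsetSum _ (fun i _ => (hZ2 i).integrable_sq)]
    refine le_trans (Finset.sum_le_sum fun i _ => ?_) htr
    have h1 : ∫ ω, Z ω i ^ 2 ∂μ = D i i := by
      rw [hDZ]
      simp_rw [sq]
    have h2 : 0 ≤ ∫ ω, Y ω i * Y ω i ∂μ := integral_nonneg fun ω => mul_self_nonneg _
    rw [h1]
    simp only [hD, hS, Matrix.sub_apply, Matrix.of_apply]
    linarith
  have hfin : ∑ i, ∑ j, (D i j) ^ 2 ≤ 1 / t := by
    rw [hF]
    refine (integral_mono_ae ?_ ?_ hpt).trans ?_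
    · simp_rw [mul_assoc]
      exact integrable_finsetSum _ (fun i _ => integrable_finsetSum _
        (fun j _ => (hintZ i j).const_mul (D i j)))
    · exact (integrable_finsetSum _ (fun i _ => (hZ2 i).integrable_sq)).const_mul _
    · rw [integral_const_mul]
      calc (1 / t : ℝ) * ∫ ω, ∑ i, Z ω i ^ 2 ∂μ ≤ (1 / t : ℝ) * 1 :=
            mul_le_mul_of_nonneg_left hEZ (by positivity)
        _ = 1 / t := mul_one _
  unfold frobNorm
  calc Real.sqrt (∑ i, ∑ j, (D i j) ^ 2) ≤ Real.sqrt (1 / t) := Real.sqrt_le_sqrt hfin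
    _ = 1 / Real.sqrt t := by rw [Real.sqrt_div zero_le_one, Real.sqrt_one]

/-- **PCA lemma.** Let `‖X‖₂ ≤ 1` a.s., `S = 𝔼[XXᵀ]`, and let `P` be the orthogonal
projection onto the span of the eigenvectors of `S` corresponding to its `t ≥ 1` largest
eigenvalues (given an orthonormal eigenbasis `u` with eigenvalues `d` in decreasing order,
`P = ∑_{i < t} uᵢuᵢᵀ`). Then `Y = 𝔼[X ∣ PX]` satisfies
`‖Σ_X - Σ_Y‖_F = ‖𝔼[XXᵀ] - 𝔼[YYᵀ]‖_F ≤ 1/√t`. -/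
theorem pca_lemma
    (Ω : Type) [MeasurableSpace Ω] (μ : Measure Ω) [IsProbabilityMeasure μ]
    (m : ℕ) (X : Ω → Fin m → ℝ) (hXmeas : Measurable X)
    (hXnorm : ∀ᵐ ω ∂μ, Real.sqrt (∑ i, X ω i ^ 2) ≤ 1)
    (S : Matrix (Fin m) (Fin m) ℝ)
    (hS : S = Matrix.of fun i j => ∫ ω, X ω i * X ω j ∂μ)
    (u : Fin m → Fin m → ℝ) (d : Fin m → ℝ)
    (hortho : ∀ i j, (∑ l, u i l * u j l) = if i = j then 1 else 0)
    (heig : ∀ i, S.mulVec (u i) = d i • u i)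
    (hsorted : ∀ i j : Fin m, i ≤ j → d j ≤ d i)
    (t : ℕ) (ht : 1 ≤ t)
    (P : Matrix (Fin m) (Fin m) ℝ)
    (hP : P = Matrix.of fun a b =>
      ∑ i ∈ Finset.univ.filter (fun i : Fin m => (i : ℕ) < t), u i a * u i b)
    (Y : Ω → Fin m → ℝ)
    (hY : Y = fun ω i => (μ[fun ω' => X ω' i |
      MeasurableSpace.comap (fun ω'' => P.mulVec (X ω'')) inferInstance]) ω) :
    frobNorm (covMatrix μ X - covMatrix μ Y) =
        frobNorm ((Matrix.of fun i j => ∫ ω, X ω i * X ω j ∂μ) -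
          (Matrix.of fun i j => ∫ ω, Y ω i * Y ω j ∂μ)) ∧
      frobNorm (covMatrix μ X - covMatrix μ Y) ≤ 1 / Real.sqrt t := by
  refine pca_core Ω (MeasurableSpace.comap (fun ω'' => P.mulVec (X ω'')) inferInstance) ?_ μ m X
    hXmeas hXnorm S hS u d hortho heig hsorted t ht ?_ Y hY
  · have hcont : Continuous (fun v : Fin m → ℝ => P.mulVec v) :=
      Continuous.matrix_mulVec continuous_const continuous_id
    exact (hcont.measurable.comp hXmeas).comap_le
  · intro k hk
    have e : (fun ω => ∑ l, u k l * X ω l) = fun ω => ∑ l, u k l * (P.mulVec (X ω)) l := by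
      funext ω
      have : ∀ b, ∑ l, u k l * P l b = u k b := by
        intro b
        simp only [hP, Matrix.of_apply, Finset.mul_sum]
        rw [Finset.sum_comm]
        simp_rw [← mul_assoc, ← Finset.sum_mul, hortho]
        simp [hk]
      simp only [Matrix.mulVec, dotProduct, Finset.mul_sum]
      rw [Finset.sum_comm]
      simp_rw [← mul_assoc, ← Finset.sum_mul, this]
    rw [e]
    have hg : Measurable (fun v : Fin m → ℝ => ∑ l, u k l * v l) := by fun_prop
    exact (hg.comp (comap_measurable (fun ω'' => P.mulVec (X ω'')))).stronglyMeasurable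
end

section
/- There is an absolute constant C > 0 such that the following holds. Let x₁, …, x_n ∈ ℝ^m satisfy ‖x_i‖₂ ≤ 1 for all i, and let 3 ≤ k ≤ n. Then there exists a partition [n] = I₁ ∪ ⋯ ∪ I_k into k nonempty parts with |I_j| ≥ ⌊n/k⌋ for all j ∈ [k] such that, with X the random vector taking value x_i with probability 1/n each, and Y the random vector taking value y_{I(i)} := (1/|I(i)|) Σ_{j ∈ I(i)} x_j with probability 1/n for each i ∈ [n] (where I(i) is the part containing i), one has ‖Σ_X − Σ_Y‖_F ≤ C / √(log k). -/
open Finset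

/-- class averages -/
noncomputable def avg {n : ℕ} {β : Type} [DecidableEq β] (Q : Fin n → β) (u : Fin n → ℝ)
    (i : Fin n) : ℝ :=
  ((univ.filter (fun i' => Q i' = Q i)).card : ℝ)⁻¹ * ∑ i' ∈ univ.filter (fun i' => Q i' = Q i), u i'

lemma avg_const {n : ℕ} {β : Type} [DecidableEq β] (Q : Fin n → β) (u : Fin n → ℝ)
    (i j : Fin n) (h : Q i = Q j) : avg Q u i = avg Q u j := by
  unfold avg; rw [h]

lemma avg_orth {n : ℕ} {β : Type} [DecidableEq β] (Q : Fin n → β) (u h : Fin n → ℝ)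
    (hh : ∀ i j, Q i = Q j → h i = h j) : ∑ i, h i * (u i - avg Q u i) = 0 := by
  have key : ∑ i, h i * avg Q u i = ∑ i, h i * u i := by
    unfold avg
    simp only [Finset.sum_filter, Finset.mul_sum]
    rw [Finset.sum_comm]
    refine Finset.sum_congr rfl fun i' _ => ?_
    have : ∀ i, h i * (((univ.filter (fun j => Q j = Q i)).card : ℝ)⁻¹ *
        (if Q i' = Q i then u i' else 0)) =
        if Q i = Q i' then h i' * (((univ.filter (fun j => Q j = Q i')).card : ℝ)⁻¹ * u i') else 0 := by
      intro i
      by_cases hi : Q i = Q i'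
      · simp [hi, hh i i' hi]
      · have : ¬ Q i' = Q i := fun e => hi e.symm
        simp [hi, this]
    rw [Finset.sum_congr rfl fun i _ => this i, ← Finset.sum_filter, Finset.sum_const, nsmul_eq_mul]
    have hc : ((univ.filter (fun j => Q j = Q i')).card : ℝ) ≠ 0 := by
      have : 0 < (univ.filter (fun j => Q j = Q i')).card := Finset.card_pos.2 ⟨i', by simp⟩
      positivity
    field_simp
  simp only [mul_sub, Finset.sum_sub_distrib, key, sub_self]

lemma energy_step {n : ℕ} {β γ : Type} [DecidableEq β] [DecidableEq γ] (Q : Fin n → β)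
    (Q' : Fin n → γ) (u s : Fin n → ℝ) (href : ∀ i j, Q' i = Q' j → Q i = Q j)
    (hs : ∀ i j, Q' i = Q' j → s i = s j) (hs1 : ∀ i, s i ^ 2 = 1) :
    n * ∑ i, (u i - avg Q' u i) ^ 2 + (∑ i, s i * (u i - avg Q u i)) ^ 2
      ≤ n * ∑ i, (u i - avg Q u i) ^ 2 := by
  have hd : ∀ i j, Q' i = Q' j → avg Q' u i - avg Q u i = avg Q' u j - avg Q u j := by
    intro i j h
    rw [avg_const Q' u i j h, avg_const Q u i j (href i j h)]
  have h1 := avg_orth Q' u _ hd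
  have h2 := avg_orth Q' u s hs
  have e1 : ∑ i, (u i - avg Q u i) ^ 2 = ∑ i, (u i - avg Q' u i) ^ 2
      + ∑ i, (avg Q' u i - avg Q u i) ^ 2 := by
    have : ∑ i, (u i - avg Q u i) ^ 2 = ∑ i, (u i - avg Q' u i) ^ 2
      + ∑ i, (avg Q' u i - avg Q u i) ^ 2 +
       2 * ∑ i, (avg Q' u i - avg Q u i) * (u i - avg Q' u i) := by
      rw [Finset.mul_sum, ← Finset.sum_add_distrib, ← Finset.sum_add_distrib]
      exact Finset.sum_congr rfl fun i _ => by ring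
    rw [this, h1]; ring
  have e2 : ∑ i, s i * (u i - avg Q u i) = ∑ i, s i * (avg Q' u i - avg Q u i) := by
    have : ∑ i, s i * (u i - avg Q u i) = ∑ i, s i * (avg Q' u i - avg Q u i) +
       ∑ i, s i * (u i - avg Q' u i) := by
      rw [← Finset.sum_add_distrib]
      exact Finset.sum_congr rfl fun i _ => by ring
    rw [this, h2, add_zero]
  have e3 := Finset.sum_mul_sq_le_sq_mul_sq univ s (fun i => avg Q' u i - avg Q u i)
  simp only [hs1, Finset.sum_const, Finset.card_univ, Fintype.card_fin, nsmul_eq_mul, mul_one] at e3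
  rw [e1, e2]
  linarith

/-- Rademacher system on a finite probability space. -/
lemma rademacher (p : ℕ) : ∃ (Ω : Type) (_ : Fintype Ω) (_ : Nonempty Ω) (ε : Ω → Fin p → ℝ),
    ∀ w : Fin p → ℝ,
      ∑ ω, (∑ c, ε ω c * w c) ^ 2 = Fintype.card Ω * ∑ c, w c ^ 2 ∧
      ∑ ω, (∑ c, ε ω c * w c) ^ 4 ≤ Fintype.card Ω * (3 * (∑ c, w c ^ 2) ^ 2) := by
  induction p with
  | zero => exact ⟨Unit, inferInstance, inferInstance, fun _ _ => 0, fun w => by simp⟩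
  | succ p ih =>
    obtain ⟨Ω, _, _, ε, h⟩ := ih
    refine ⟨Ω × Bool, inferInstance, inferInstance,
      fun ω => Fin.cons (if ω.2 then 1 else -1) (ε ω.1), fun w => ?_⟩
    obtain ⟨h2, h4⟩ := h (fun c => w c.succ)
    simp only [Fintype.sum_prod_type, Fin.sum_univ_succ, Fin.cons_zero, Fin.cons_succ,
      Fintype.sum_bool, Fintype.card_prod, Fintype.card_bool, if_true, Bool.false_eq_true, if_false]
    set A := ∑ c : Fin p, w c.succ ^ 2 with hA
    have hA0 : 0 ≤ A := Finset.sum_nonneg fun _ _ => sq_nonneg _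
    push_cast
    constructor
    · have : ∀ ω, (1 * w 0 + ∑ c : Fin p, ε ω c * w c.succ) ^ 2 +
          (-1 * w 0 + ∑ c : Fin p, ε ω c * w c.succ) ^ 2 =
          2 * (∑ c : Fin p, ε ω c * w c.succ) ^ 2 + 2 * w 0 ^ 2 := fun ω => by ring
      simp only [this, Finset.sum_add_distrib, ← Finset.mul_sum, h2, Finset.sum_const,
        Finset.card_univ, nsmul_eq_mul]
      ring
    · have : ∀ ω, (1 * w 0 + ∑ c : Fin p, ε ω c * w c.succ) ^ 4 +
          (-1 * w 0 + ∑ c : Fin p, ε ω c * w c.succ) ^ 4 =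
          2 * (∑ c : Fin p, ε ω c * w c.succ) ^ 4 +
          12 * w 0 ^ 2 * (∑ c : Fin p, ε ω c * w c.succ) ^ 2 + 2 * w 0 ^ 4 := fun ω => by ring
      simp only [this, Finset.sum_add_distrib, ← Finset.mul_sum, h2, Finset.sum_const,
        Finset.card_univ, nsmul_eq_mul]
      have hc : (0:ℝ) ≤ Fintype.card Ω * w 0 ^ 4 := by positivity
      nlinarith

lemma clip_tail (t : ℝ) : |max (-1) (min 1 t)| ≤ 1 ∧ (t - max (-1) (min 1 t)) ^ 2 ≤ t ^ 4 / 16 := by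
  have key : ∀ a b : ℝ, |a| ≤ b → a ^ 2 ≤ b ^ 2 := fun a b h => by
    have := abs_nonneg a
    nlinarith [sq_abs a]
  refine ⟨?_, ?_⟩
  · rw [abs_le]; exact ⟨le_max_left _ _, max_le (by norm_num) (min_le_left _ _)⟩
  · have : |t - max (-1) (min 1 t)| ≤ t ^ 2 / 4 := by
      rcases le_total t 1 with h | h
      · rcases le_total t (-1) with h' | h'
        · rw [min_eq_right h, max_eq_left h', abs_le]
          constructor <;> nlinarith [sq_nonneg (t + 2), sq_nonneg (t-2)]
        · rw [min_eq_right h, max_eq_right h', sub_self, abs_zero]; positivity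
      · rw [min_eq_left h, max_eq_right (by norm_num), abs_le]
        constructor <;> nlinarith [sq_nonneg (t + 2), sq_nonneg (t-2)]
    have := key _ _ this
    linarith

/-- rounding to the vertices of the cube -/
lemma round_signs {n m : ℕ} (b : Fin n → Fin m → ℝ) (s : Fin n → ℝ) (hs : ∀ i, |s i| ≤ 1) :
    ∃ s' : Fin n → ℝ, (∀ i, s' i = 1 ∨ s' i = -1) ∧
      ∑ a, (∑ i, s i * b i a) ^ 2 ≤ ∑ a, (∑ i, s' i * b i a) ^ 2 := by
  have main : ∀ T : Finset (Fin n), ∃ s' : Fin n → ℝ, (∀ i ∈ T, s' i = 1 ∨ s' i = -1) ∧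
      (∀ i, |s' i| ≤ 1) ∧
      ∑ a, (∑ i, s i * b i a) ^ 2 ≤ ∑ a, (∑ i, s' i * b i a) ^ 2 := by
    intro T
    induction T using Finset.induction_on with
    | empty => exact ⟨s, by simp, hs, le_rfl⟩
    | insert j T hj ih =>
      obtain ⟨s', h1, h2, h3⟩ := ih
      have form : ∀ t a, ∑ i, Function.update s' j t i * b i a =
          t * b j a + ∑ i ∈ univ.erase j, s' i * b i a := by
        intro t a
        rw [← Finset.add_sum_erase univ _ (Finset.mem_univ j), Function.update_self]
        congr 1
        refine Finset.sum_congr rfl fun i hi => ?_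
        rw [Function.update_of_ne (Finset.ne_of_mem_erase hi)]
      have conv : ∑ a, (∑ i, s' i * b i a) ^ 2 ≤
          (1 + s' j) / 2 * ∑ a, (∑ i, Function.update s' j 1 i * b i a) ^ 2 +
          (1 - s' j) / 2 * ∑ a, (∑ i, Function.update s' j (-1) i * b i a) ^ 2 := by
        rw [Finset.mul_sum, Finset.mul_sum, ← Finset.sum_add_distrib]
        refine Finset.sum_le_sum fun a _ => ?_
        have e := form (s' j) a
        rw [Function.update_eq_self] at e
        rw [e, form, form]
        have := abs_le.1 (h2 j)
        nlinarith [mul_nonneg (mul_nonneg (by linarith : 0 ≤ 1 + s' j) (by linarith : 0 ≤ 1 - s' j)) (sq_nonneg (b j a))]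
      have hb := abs_le.1 (h2 j)
      have fin : ∀ t : ℝ, (t = 1 ∨ t = -1) →
          ∑ a, (∑ i, s' i * b i a) ^ 2 ≤ ∑ a, (∑ i, Function.update s' j t i * b i a) ^ 2 →
          ∃ s' : Fin n → ℝ, (∀ i ∈ insert j T, s' i = 1 ∨ s' i = -1) ∧
      (∀ i, |s' i| ≤ 1) ∧
      ∑ a, (∑ i, s i * b i a) ^ 2 ≤ ∑ a, (∑ i, s' i * b i a) ^ 2 := by
        intro t ht hle
        refine ⟨Function.update s' j t, ?_, ?_, h3.trans hle⟩
        · intro i hi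
          by_cases hij : i = j
          · subst hij; simpa using ht
          · rw [Function.update_of_ne hij]; exact h1 i (Finset.mem_of_mem_insert_of_ne hi hij)
        · intro i
          by_cases hij : i = j
          · subst hij; rcases ht with rfl | rfl <;> simp
          · rw [Function.update_of_ne hij]; exact h2 i
      by_contra hcon
      have n1 := lt_of_not_ge fun h => hcon (fin 1 (Or.inl rfl) h)
      have n2 := lt_of_not_ge fun h => hcon (fin (-1) (Or.inr rfl) h)
      rcases eq_or_lt_of_le hb.1 with h | h
      · nlinarith
      · nlinarith
  obtain ⟨s', h1, _, h3⟩ := main univ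
  exact ⟨s', fun i => h1 i (Finset.mem_univ i), h3⟩

lemma rademacher' (p : ℕ) : ∃ (N : ℕ) (_ : 0 < N) (ε : Fin N → Fin p → ℝ),
    ∀ w : Fin p → ℝ,
      ∑ ω, (∑ c, ε ω c * w c) ^ 2 = N * ∑ c, w c ^ 2 ∧
      ∑ ω, (∑ c, ε ω c * w c) ^ 4 ≤ N * (3 * (∑ c, w c ^ 2) ^ 2) := by
  obtain ⟨Ω, _, _, ε, h⟩ := rademacher p
  refine ⟨Fintype.card Ω, Fintype.card_pos, fun ω => ε ((Fintype.equivFin Ω).symm ω), fun w => ?_⟩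
  obtain ⟨h2, h4⟩ := h w
  constructor
  · rw [← h2]
    exact (Fintype.equivFin Ω).symm.sum_comp (fun ω => (∑ c, ε ω c * w c) ^ 2)
  · rw [(Fintype.equivFin Ω).symm.sum_comp (fun ω => (∑ c, ε ω c * w c) ^ 4)]
    exact h4

lemma groth_step {n m : ℕ} (b : Fin n → Fin m → ℝ) (Γ D : ℝ)
    (hΓ : ∀ s : Fin n → ℝ, (∀ i, |s i| ≤ 1) → ∑ a, (∑ i, s i * b i a) ^ 2 ≤ Γ)
    (hD : ∀ (p : ℕ) (x : Fin n → Fin p → ℝ), (∀ i, ∑ c, x i c ^ 2 ≤ 1) →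
      ∑ c, ∑ a, (∑ i, x i c * b i a) ^ 2 ≤ D)
    (p : ℕ) (x : Fin n → Fin p → ℝ) (hx : ∀ i, ∑ c, x i c ^ 2 ≤ 1) :
      ∑ c, ∑ a, (∑ i, x i c * b i a) ^ 2 ≤ 2 * Γ + D / 2 := by
  obtain ⟨N, hN, ε, h⟩ := rademacher' p
  have hN' : (0:ℝ) < N := by exact_mod_cast hN
  set g : Fin n → Fin N → ℝ := fun i ω => ∑ c, ε ω c * x i c with hg
  set cl : Fin n → Fin N → ℝ := fun i ω => max (-1) (min 1 (g i ω)) with hcl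
  have c1 : ∑ ω, ∑ a, (∑ i, cl i ω * b i a) ^ 2 ≤ N * Γ := by
    have : ∑ ω : Fin N, ∑ a, (∑ i, cl i ω * b i a) ^ 2 ≤ ∑ _ω : Fin N, Γ :=
      Finset.sum_le_sum fun ω _ => hΓ _ fun i => (clip_tail _).1
    simpa using this
  have c2 : ∑ ω, ∑ a, (∑ i, (g i ω - cl i ω) * b i a) ^ 2 ≤ N * (D / 4) := by
    have h1 := hD N (fun i ω => 2 / Real.sqrt N * (g i ω - cl i ω)) (by
      intro i
      have hsq : (2 / Real.sqrt N) ^ 2 = 4 / N := by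
        rw [div_pow, Real.sq_sqrt hN'.le]; norm_num
      simp only [mul_pow, hsq, ← Finset.mul_sum]
      have t1 : ∑ ω, (g i ω - cl i ω) ^ 2 ≤ ∑ ω, g i ω ^ 4 / 16 :=
        Finset.sum_le_sum fun ω _ => (clip_tail _).2
      rw [← Finset.sum_div] at t1
      have t2 := (h (x i)).2
      have t3 : (∑ c, x i c ^ 2) ^ 2 ≤ 1 :=
        pow_le_one₀ (Finset.sum_nonneg fun _ _ => sq_nonneg _) (hx i)
      have t4 : ∑ ω, (g i ω - cl i ω) ^ 2 ≤ N * 3 / 16 := by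
        refine t1.trans ?_
        have : ∑ ω, g i ω ^ 4 ≤ N * (3 * 1) := t2.trans (by gcongr)
        linarith
      calc 4 / (N:ℝ) * ∑ ω, (g i ω - cl i ω) ^ 2 ≤ 4 / N * (N * 3 / 16) := by gcongr
        _ = 3 / 4 := by field_simp; norm_num
        _ ≤ 1 := by norm_num)
    have hsq : (2 / Real.sqrt N) ^ 2 = 4 / N := by
      rw [div_pow, Real.sq_sqrt hN'.le]; norm_num
    simp only [mul_assoc, ← Finset.mul_sum, mul_pow, hsq] at h1
    rw [div_mul_eq_mul_div, div_le_iff₀ hN'] at h1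
    linarith
  have c3 : N * ∑ c, ∑ a, (∑ i, x i c * b i a) ^ 2 = ∑ ω, ∑ a, (∑ i, g i ω * b i a) ^ 2 := by
    rw [Finset.sum_comm, Finset.mul_sum, Finset.sum_comm (s := (univ : Finset (Fin N)))]
    refine Finset.sum_congr rfl fun a _ => ?_
    rw [← (h (fun c => ∑ i, x i c * b i a)).1]
    refine Finset.sum_congr rfl fun ω _ => ?_
    congr 1
    simp only [hg, Finset.mul_sum, Finset.sum_mul]
    rw [Finset.sum_comm]
    exact Finset.sum_congr rfl fun i _ => Finset.sum_congr rfl fun c _ => by ring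
  have c4 : ∑ ω, ∑ a, (∑ i, g i ω * b i a) ^ 2 ≤
      2 * ∑ ω, ∑ a, (∑ i, cl i ω * b i a) ^ 2 +
      2 * ∑ ω, ∑ a, (∑ i, (g i ω - cl i ω) * b i a) ^ 2 := by
    simp only [Finset.mul_sum, ← Finset.sum_add_distrib]
    refine Finset.sum_le_sum fun ω _ => Finset.sum_le_sum fun a _ => ?_
    have : ∑ i, g i ω * b i a = ∑ i, cl i ω * b i a + ∑ i, (g i ω - cl i ω) * b i a := by
      rw [← Finset.sum_add_distrib]
      exact Finset.sum_congr rfl fun i _ => by ring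
    rw [this]
    nlinarith [sq_nonneg (∑ i, cl i ω * b i a - ∑ i, (g i ω - cl i ω) * b i a)]
  have : N * ∑ c, ∑ a, (∑ i, x i c * b i a) ^ 2 ≤ N * (2 * Γ + D / 2) := by
    rw [c3]; linarith
  exact le_of_mul_le_mul_left this hN'

lemma groth {n m : ℕ} (b : Fin n → Fin m → ℝ) (Γ : ℝ)
    (hΓ : ∀ s : Fin n → ℝ, (∀ i, |s i| ≤ 1) → ∑ a, (∑ i, s i * b i a) ^ 2 ≤ Γ)
    (p : ℕ) (x : Fin n → Fin p → ℝ) (hx : ∀ i, ∑ c, x i c ^ 2 ≤ 1) :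
      ∑ c, ∑ a, (∑ i, x i c * b i a) ^ 2 ≤ 4 * Γ := by
  have hit : ∀ k : ℕ, ∀ (p : ℕ) (x : Fin n → Fin p → ℝ), (∀ i, ∑ c, x i c ^ 2 ≤ 1) →
      ∑ c, ∑ a, (∑ i, x i c * b i a) ^ 2 ≤
        4 * Γ + (n * (∑ a, ∑ i, b i a ^ 2)  - 4 * Γ) * (1 / 2) ^ k := by
    intro k
    induction k with
    | zero =>
      intro p x hx
      have : ∑ c, ∑ a, (∑ i, x i c * b i a) ^ 2 ≤
          ∑ c, ∑ a, (∑ i, x i c ^ 2) * (∑ i, b i a ^ 2) :=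
        Finset.sum_le_sum fun c _ => Finset.sum_le_sum fun a _ =>
          Finset.sum_mul_sq_le_sq_mul_sq _ _ _
      refine this.trans ?_
      simp only [← Finset.mul_sum, ← Finset.sum_mul]
      rw [Finset.sum_comm]
      have h2 : ∑ i, ∑ c, x i c ^ 2 ≤ n := by
        have : ∑ i, ∑ c, x i c ^ 2 ≤ ∑ _i : Fin n, (1:ℝ) := Finset.sum_le_sum fun i _ => hx i
        simpa using this
      have h3 : 0 ≤ ∑ a, ∑ i, b i a ^ 2 :=
        Finset.sum_nonneg fun _ _ => Finset.sum_nonneg fun _ _ => sq_nonneg _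
      have := mul_le_mul_of_nonneg_right h2 h3
      simpa using this
    | succ k ih =>
      intro p x hx
      have := groth_step b Γ _ hΓ ih p x hx
      rw [pow_succ]
      linarith
  have lim : Filter.Tendsto (fun k : ℕ => 4 * Γ + (n * (∑ a, ∑ i, b i a ^ 2)  - 4 * Γ) * (1 / 2) ^ k)
      Filter.atTop (nhds (4 * Γ + (n * (∑ a, ∑ i, b i a ^ 2)  - 4 * Γ) * 0)) :=
    ((tendsto_pow_atTop_nhds_zero_of_lt_one (by norm_num) (by norm_num)).const_mul _).const_add _
  have := ge_of_tendsto' lim (fun k => hit k p x hx)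
  simpa using this

/-- There is a good choice of signs. -/
lemma exists_signs {n m : ℕ} (b : Fin n → Fin m → ℝ)
    (p : ℕ) (x : Fin n → Fin p → ℝ) (hx : ∀ i, ∑ c, x i c ^ 2 ≤ 1) :
    ∃ s : Fin n → ℝ, (∀ i, s i = 1 ∨ s i = -1) ∧
      ∑ c, ∑ a, (∑ i, x i c * b i a) ^ 2 ≤ 4 * ∑ a, (∑ i, s i * b i a) ^ 2 := by
  have hfin : (Set.Finite {s : Fin n → ℝ | ∀ i, s i = 1 ∨ s i = -1}) := by
    have : {s : Fin n → ℝ | ∀ i, s i = 1 ∨ s i = -1} = Set.pi Set.univ fun _ => {1, -1} := by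
      ext s; simp
    rw [this]
    exact Set.Finite.pi fun _ => by simp
  obtain ⟨s, hs, hmax⟩ := hfin.exists_maximalFor (fun s => ∑ a, (∑ i, s i * b i a) ^ 2) _
    ⟨fun _ => 1, fun _ => Or.inl rfl⟩
  refine ⟨s, hs, groth b _ (fun t ht => ?_) p x hx⟩
  obtain ⟨t', ht', hle⟩ := round_signs b t ht
  refine hle.trans ?_
  rcases le_total (∑ a, (∑ i, s i * b i a) ^ 2) (∑ a, (∑ i, t' i * b i a) ^ 2) with h | h
  · exact hmax ht' h
  · exact h

/-- residuals -/
noncomputable def res {n m : ℕ} {β : Type} [DecidableEq β] (Q : Fin n → β) (x : Fin n → Fin m → ℝ)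
    (i : Fin n) (a : Fin m) : ℝ := x i a - avg Q (fun l => x l a) i

/-- squared Frobenius norm of the (unnormalized) second moment matrix -/
noncomputable def frob {n m : ℕ} (z : Fin n → Fin m → ℝ) : ℝ := ∑ a, ∑ b, (∑ l, z l a * z l b) ^ 2

lemma frob_nonneg {n m : ℕ} (z : Fin n → Fin m → ℝ) : 0 ≤ frob z :=
  Finset.sum_nonneg fun _ _ => Finset.sum_nonneg fun _ _ => sq_nonneg _

lemma res_orth {n m : ℕ} {β : Type} [DecidableEq β] (Q : Fin n → β) (x : Fin n → Fin m → ℝ)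
    (h : Fin n → ℝ) (hh : ∀ i j, Q i = Q j → h i = h j) (a : Fin m) :
    ∑ i, h i * res Q x i a = 0 := avg_orth Q (fun l => x l a) h hh

lemma refine_step {n m : ℕ} (x : Fin n → Fin m → ℝ) (hx : ∀ i, ∑ c, x i c ^ 2 ≤ 1)
    (Q : Fin n → ℕ) : ∃ Q' : Fin n → ℕ, (∀ i, Q' i = 2 * Q i ∨ Q' i = 2 * Q i + 1) ∧
      4 * n * (∑ a, ∑ i, res Q' x i a ^ 2) + frob (res Q x) ≤
        4 * n * (∑ a, ∑ i, res Q x i a ^ 2) := by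
  obtain ⟨s, hs, hle⟩ := exists_signs (res Q x) m x hx
  have e : ∑ c, ∑ a, (∑ i, x i c * res Q x i a) ^ 2 = frob (res Q x) := by
    refine Finset.sum_congr rfl fun c _ => Finset.sum_congr rfl fun a _ => ?_
    congr 1
    have h0 := res_orth Q x (avg Q (fun l => x l c)) (fun i j h => avg_const _ _ _ _ h) a
    rw [← sub_eq_zero, ← Finset.sum_sub_distrib, ← h0]
    refine Finset.sum_congr rfl fun i _ => ?_
    simp only [res]; ring
  rw [e] at hle
  classical
  refine ⟨fun i => if s i = 1 then 2 * Q i else 2 * Q i + 1, fun i => ?_, ?_⟩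
  · by_cases h : s i = 1 <;> simp [h]
  · set Q' : Fin n → ℕ := fun i => if s i = 1 then 2 * Q i else 2 * Q i + 1 with hQ'
    have hn : (-1 : ℝ) ≠ 1 := by norm_num
    have r1 : ∀ i j, Q' i = Q' j → Q i = Q j := by
      intro i j h
      simp only [hQ'] at h
      split_ifs at h <;> omega
    have r2 : ∀ i j, Q' i = Q' j → s i = s j := by
      intro i j h
      simp only [hQ'] at h
      rcases hs i with hi | hi <;> rcases hs j with hj | hj <;> simp [hi, hj, hn] at h ⊢ <;> omega
    have r3 : ∀ i, s i ^ 2 = 1 := by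
      intro i; rcases hs i with hi | hi <;> simp [hi]
    have := Finset.sum_le_sum fun a (_ : a ∈ (univ : Finset (Fin m))) =>
      energy_step Q Q' (fun l => x l a) s r1 r2 r3
    rw [Finset.sum_add_distrib, ← Finset.mul_sum, ← Finset.mul_sum] at this
    simp only [res] at hle ⊢
    linarith

lemma exists_Q {n m : ℕ} (hn : 0 < n) (x : Fin n → Fin m → ℝ) (hx : ∀ i, ∑ c, x i c ^ 2 ≤ 1)
    (T : ℕ) : ∃ Q : Fin n → ℕ, (∀ i, Q i < 2 ^ T) ∧ frob (res Q x) ≤ 4 * n ^ 2 / (T + 1) := by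
  have hn' : (0:ℝ) < n := by exact_mod_cast hn
  by_contra hcon
  push Not at hcon
  set δ : ℝ := 4 * n ^ 2 / (T + 1) with hδ
  have main : ∀ t : ℕ, t ≤ T → ∃ Q : Fin n → ℕ, (∀ i, Q i < 2 ^ t) ∧
      4 * n * (∑ a, ∑ i, res Q x i a ^ 2) + t * δ ≤ 4 * n ^ 2 := by
    intro t
    induction t with
    | zero =>
      intro _
      refine ⟨fun _ => 0, by simp, ?_⟩
      have h1 : ∀ a, ∑ i, res (fun _ : Fin n => (0:ℕ)) x i a ^ 2 ≤ ∑ i, x i a ^ 2 := by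
        intro a
        have h0 := res_orth (fun _ : Fin n => (0:ℕ)) x (avg (fun _ : Fin n => (0:ℕ)) (fun l => x l a))
          (fun i j h => avg_const _ _ _ _ h) a
        have : ∑ i, x i a ^ 2 = ∑ i, res (fun _ : Fin n => (0:ℕ)) x i a ^ 2 +
          2 * ∑ i, avg (fun _ : Fin n => (0:ℕ)) (fun l => x l a) i * res (fun _ : Fin n => (0:ℕ)) x i a
          + ∑ i, avg (fun _ : Fin n => (0:ℕ)) (fun l => x l a) i ^ 2 := by
          rw [Finset.mul_sum, ← Finset.sum_add_distrib, ← Finset.sum_add_distrib]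
          refine Finset.sum_congr rfl fun i _ => ?_
          simp only [res]; ring
        rw [this, h0]
        have : 0 ≤ ∑ i, avg (fun _ : Fin n => (0:ℕ)) (fun l => x l a) i ^ 2 :=
          Finset.sum_nonneg fun _ _ => sq_nonneg _
        linarith
      have h2 : ∑ a, ∑ i, res (fun _ : Fin n => (0:ℕ)) x i a ^ 2 ≤ n := by
        refine (Finset.sum_le_sum fun a _ => h1 a).trans ?_
        rw [Finset.sum_comm]
        have : ∑ i, ∑ c, x i c ^ 2 ≤ ∑ _i : Fin n, (1:ℝ) := Finset.sum_le_sum fun i _ => hx i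
        simpa using this
      push_cast
      nlinarith
    | succ t ih =>
      intro ht
      obtain ⟨Q, h1, h2⟩ := ih (by omega)
      obtain ⟨Q', h3, h4⟩ := refine_step x hx Q
      have h5 := hcon Q fun i => (h1 i).trans_le (Nat.pow_le_pow_right (by norm_num) (by omega))
      refine ⟨Q', fun i => ?_, ?_⟩
      · have := h1 i
        rw [pow_succ]
        rcases h3 i with h | h <;> omega
      · push_cast
        linarith
  obtain ⟨Q, h1, h2⟩ := main T le_rfl
  have h5 := hcon Q h1
  obtain ⟨Q', h3, h4⟩ := refine_step x hx Q
  have h6 : 0 ≤ ∑ a, ∑ i, res Q' x i a ^ 2 :=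
    Finset.sum_nonneg fun _ _ => Finset.sum_nonneg fun _ _ => sq_nonneg _
  have h7 : ((T:ℝ) + 1) * δ = 4 * n ^ 2 := by rw [hδ]; field_simp
  have h8 : 0 ≤ 4 * n * (∑ a, ∑ i, res Q' x i a ^ 2) := by positivity
  linarith

/-- balanced interval partition -/
lemma blocks (n k : ℕ) (hk : 0 < k) (hkn : k ≤ n) : ∃ g : Fin n → Fin k, Monotone g ∧
    ∀ j, n / k ≤ (univ.filter (fun i => g i = j)).card ∧
      (univ.filter (fun i => g i = j)).card ≤ n / k + 1 := by
  have hn : 0 < n := by omega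
  refine ⟨fun i => ⟨i * k / n, by
    rw [Nat.div_lt_iff_lt_mul hn, mul_comm k n]
    exact Nat.mul_lt_mul_of_pos_right i.2 hk⟩, ?_, ?_⟩
  · intro i j hij
    show (i:ℕ) * k / n ≤ j * k / n
    exact Nat.div_le_div_right (Nat.mul_le_mul_right _ hij)
  · intro j
    have hcard : (univ.filter (fun i : Fin n => (⟨i * k / n, by
      rw [Nat.div_lt_iff_lt_mul hn, mul_comm k n]
      exact Nat.mul_lt_mul_of_pos_right i.2 hk⟩ : Fin k) = j)).card =
      ((Finset.range n).filter (fun p => p * k / n = j)).card := by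
      rw [← Finset.card_map Fin.valEmbedding]
      congr 1
      ext p
      simp only [Finset.mem_map, Finset.mem_filter, Finset.mem_univ, true_and,
        Fin.valEmbedding_apply, Finset.mem_range, Fin.ext_iff]
      constructor
      · rintro ⟨a, h, rfl⟩; exact ⟨a.2, h⟩
      · rintro ⟨h1, h2⟩; exact ⟨⟨p, h1⟩, h2, rfl⟩
    rw [hcard]
    -- first element
    set p0 := (j * n + (k - 1)) / k with hp0
    have hp1 : j * n ≤ p0 * k := by
      have h1 := Nat.div_add_mod (j * n + (k - 1)) k
      rw [← hp0] at h1
      have := Nat.mod_lt (j * n + (k - 1)) hk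
      rw [mul_comm p0 k]; omega
    have hp2 : p0 * k < j * n + k := by
      have h1 := Nat.div_mul_le_self (j * n + (k - 1)) k
      rw [← hp0] at h1
      omega
    have hq : n / k * k ≤ n := Nat.div_mul_le_self n k
    have hjk : (j + 1) * n ≤ k * n := Nat.mul_le_mul_right _ j.2
    constructor
    · have : Finset.Ico p0 (p0 + n / k) ⊆ (Finset.range n).filter (fun p => p * k / n = j) := by
        intro p hp
        rw [Finset.mem_Ico] at hp
        have a1 : p0 * k ≤ p * k := Nat.mul_le_mul_right _ hp.1
        have a2 : (p + 1) * k ≤ (p0 + n / k) * k := Nat.mul_le_mul_right _ hp.2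
        have a3 : p * k < (j + 1) * n := by
          rw [add_mul, add_mul] at a2
          rw [add_mul]; omega
        rw [Finset.mem_filter, Finset.mem_range]
        refine ⟨?_, ?_⟩
        · have : p * k < n * k := by rw [mul_comm n k]; omega
          exact lt_of_mul_lt_mul_right this (Nat.zero_le _)
        · exact Nat.div_eq_of_lt_le (by omega) a3
      simpa using Finset.card_le_card this
    · have : (Finset.range n).filter (fun p => p * k / n = j) ⊆ Finset.Ico p0 (p0 + (n / k + 1)) := by
        intro p hp
        rw [Finset.mem_filter, Finset.mem_range] at hp
        have b1 : j * n ≤ p * k := by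
          rw [← hp.2]; exact Nat.div_mul_le_self _ _
        have b2 : p * k < (j + 1) * n := by
          rw [← hp.2]; exact Nat.lt_mul_of_div_lt (Nat.lt_succ_self _) hn
        have b3 : n < (n / k + 1) * k := Nat.lt_mul_of_div_lt (Nat.lt_succ_self _) hk
        rw [Finset.mem_Ico]
        refine ⟨?_, ?_⟩
        · have : p0 * k < (p + 1) * k := by rw [add_mul p]; omega
          exact Nat.lt_succ_iff.1 (lt_of_mul_lt_mul_right this (Nat.zero_le _))
        · have : p * k < (p0 + (n / k + 1)) * k := by
            rw [add_mul p0]; rw [add_mul (j:ℕ)] at b2; omega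
          exact lt_of_mul_lt_mul_right this (Nat.zero_le _)
      simpa using Finset.card_le_card this

/-- balanced partition nearly refining `Q` -/
lemma exists_f (n k r : ℕ) (hk : 0 < k) (hkn : k ≤ n) (Q : Fin n → ℕ) (hQ : ∀ i, Q i < r) :
    ∃ (f : Fin n → Fin k) (J : Finset (Fin k)), (∀ j, n / k ≤ (univ.filter (fun i => f i = j)).card) ∧
      (∀ i i', f i = f i' → f i ∉ J → Q i = Q i') ∧
      (univ.filter (fun i => f i ∈ J)).card ≤ r * (n / k + 1) := by
  obtain ⟨g, hg, hc⟩ := blocks n k hk hkn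
  set σ := Tuple.sort Q
  have hσ : Monotone (Q ∘ σ) := Tuple.monotone_sort Q
  have hcard : ∀ j, (univ.filter (fun i => g (σ.symm i) = j)).card =
      (univ.filter (fun i => g i = j)).card := by
    intro j
    refine Finset.card_bij (fun i _ => σ.symm i) ?_ ?_ ?_
    · intro i hi; simpa using hi
    · intro i _ i' _ h; simpa using h
    · intro i hi; exact ⟨σ i, by simpa using hi, by simp⟩
  classical
  set J : Finset (Fin k) := univ.filter fun j => ∃ i i', g i = j ∧ g i' = j ∧ Q (σ i) < Q (σ i') with hJ
  have hJr : J.card ≤ r := by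
    have hch : ∀ j ∈ J, ∃ i i', g i = j ∧ g i' = j ∧ Q (σ i) < Q (σ i') := by
      intro j hj; simpa [hJ] using hj
    have : Nonempty (Fin n) := ⟨⟨0, by omega⟩⟩
    choose! A B h1 h2 h3 using hch
    have key : ∀ j ∈ J, ∀ j' ∈ J, j < j' → Q (σ (A j)) < Q (σ (A j')) := by
      intro j hj j' hj' hlt
      refine (h3 j hj).trans_le (hσ ?_)
      by_contra hcon
      push Not at hcon
      have := hg hcon.le
      rw [h1 j' hj', h2 j hj] at this
      exact absurd hlt (not_lt.2 this)
    have : J.card ≤ (Finset.range r).card := by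
      refine Finset.card_le_card_of_injOn (fun j => Q (σ (A j))) ?_ ?_
      · intro j _; simpa using hQ _
      · intro j hj j' hj' he
        by_contra hne
        rcases lt_or_gt_of_ne hne with h | h
        · exact absurd he (key j hj j' hj' h).ne
        · exact absurd he (key j' hj' j hj h).ne'
    simpa using this
  refine ⟨fun i => g (σ.symm i), J, fun j => ?_, ?_, ?_⟩
  · rw [hcard]; exact (hc j).1
  · intro i i' h hn
    by_contra hne
    apply hn
    simp only [hJ, Finset.mem_filter, Finset.mem_univ, true_and]
    rcases lt_or_gt_of_ne hne with h' | h'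
    · exact ⟨σ.symm i, σ.symm i', rfl, h.symm, by simpa using h'⟩
    · exact ⟨σ.symm i', σ.symm i, h.symm, rfl, by simpa using h'⟩
  · have := Finset.card_le_mul_card_image_of_maps_to (s := univ.filter (fun i => g (σ.symm i) ∈ J))
      (t := J) (f := fun i => g (σ.symm i)) (by intro i hi; simpa using hi) (n / k + 1) (by
        intro j hj
        refine le_trans ?_ (hc j).2
        rw [← hcard]
        exact Finset.card_le_card fun i hi => by
          simp only [Finset.mem_filter, Finset.mem_univ, true_and] at hi ⊢; exact hi.2)
    refine this.trans ?_
    rw [mul_comm]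
    exact Nat.mul_le_mul_right _ hJr


lemma cs_matrix {m : ℕ} (U A : Fin m → Fin m → ℝ) :
    ∑ a, ∑ b, U a b * A a b ≤ Real.sqrt (∑ a, ∑ b, U a b ^ 2) * Real.sqrt (∑ a, ∑ b, A a b ^ 2) := by
  have := Real.sum_mul_le_sqrt_mul_sqrt (univ : Finset (Fin m × Fin m)) (fun p => U p.1 p.2)
    (fun p => A p.1 p.2)
  simpa only [Fintype.sum_prod_type] using this

lemma sum_inner_sq {n m : ℕ} (v : Fin m → ℝ) (z : Fin n → Fin m → ℝ) :
    ∑ j, (∑ a, v a * z j a) ^ 2 = ∑ a, ∑ b, (v a * v b) * (∑ l, z l a * z l b) := by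
  simp only [sq, Finset.sum_mul_sum]
  simp only [Finset.mul_sum]
  rw [Finset.sum_comm]
  refine Finset.sum_congr rfl fun a _ => ?_
  rw [Finset.sum_comm]
  exact Finset.sum_congr rfl fun b _ => Finset.sum_congr rfl fun l _ => by ring

lemma sum_inner_sq_le {n m : ℕ} (v : Fin m → ℝ) (z : Fin n → Fin m → ℝ) :
    ∑ j, (∑ a, v a * z j a) ^ 2 ≤ (∑ a, v a ^ 2) * Real.sqrt (frob z) := by
  rw [sum_inner_sq]
  refine (cs_matrix (fun a b => v a * v b) (fun a b => ∑ l, z l a * z l b)).trans ?_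
  have : ∑ a, ∑ b, (v a * v b) ^ 2 = (∑ a, v a ^ 2) ^ 2 := by
    rw [sq (∑ a, v a ^ 2), Finset.sum_mul_sum]
    exact Finset.sum_congr rfl fun a _ => Finset.sum_congr rfl fun b _ => by ring
  rw [this, Real.sqrt_sq (Finset.sum_nonneg fun _ _ => sq_nonneg _)]
  exact le_rfl

lemma sum_cross {n m : ℕ} (u z : Fin n → Fin m → ℝ) :
    ∑ i, ∑ j, (∑ a, u i a * z j a) ^ 2 =
      ∑ a, ∑ b, (∑ l, u l a * u l b) * (∑ l, z l a * z l b) := by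
  simp only [sum_inner_sq]
  rw [Finset.sum_comm]
  refine Finset.sum_congr rfl fun a _ => ?_
  rw [Finset.sum_comm]
  refine Finset.sum_congr rfl fun b _ => ?_
  rw [← Finset.sum_mul]

lemma res_norm {n m : ℕ} {β : Type} [DecidableEq β] (x : Fin n → Fin m → ℝ)
    (hx : ∀ i, ∑ c, x i c ^ 2 ≤ 1) (f : Fin n → β) (i : Fin n) : ∑ a, res f x i a ^ 2 ≤ 4 := by
  set S := univ.filter (fun i' => f i' = f i) with hS
  have hc : (0:ℝ) < S.card := by
    have : 0 < S.card := Finset.card_pos.2 ⟨i, by simp [hS]⟩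
    exact_mod_cast this
  have h1 : ∑ a, avg f (fun l => x l a) i ^ 2 ≤ 1 := by
    have : ∀ a, avg f (fun l => x l a) i ^ 2 ≤ (S.card : ℝ)⁻¹ * ∑ l ∈ S, x l a ^ 2 := by
      intro a
      unfold avg
      rw [← hS, mul_pow]
      have := sq_sum_le_card_mul_sum_sq (s := S) (f := fun l => x l a)
      calc ((S.card:ℝ)⁻¹) ^ 2 * (∑ l ∈ S, x l a) ^ 2
          ≤ ((S.card:ℝ)⁻¹) ^ 2 * (S.card * ∑ l ∈ S, x l a ^ 2) := by gcongr
        _ = _ := by field_simp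
    refine (Finset.sum_le_sum fun a _ => this a).trans ?_
    rw [← Finset.mul_sum, Finset.sum_comm]
    have h2 : ∑ l ∈ S, ∑ a, x l a ^ 2 ≤ S.card := by
      have : ∑ l ∈ S, ∑ a, x l a ^ 2 ≤ ∑ _l ∈ S, (1:ℝ) := Finset.sum_le_sum fun l _ => hx l
      simpa using this
    calc (S.card:ℝ)⁻¹ * ∑ l ∈ S, ∑ a, x l a ^ 2 ≤ (S.card:ℝ)⁻¹ * S.card := by gcongr
      _ = 1 := by field_simp
  have h2 : ∑ a, res f x i a ^ 2 ≤ ∑ a, (2 * x i a ^ 2 + 2 * avg f (fun l => x l a) i ^ 2) := by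
    refine Finset.sum_le_sum fun a _ => ?_
    unfold res
    nlinarith [sq_nonneg (x i a + avg f (fun l => x l a) i)]
  rw [Finset.sum_add_distrib, ← Finset.mul_sum, ← Finset.mul_sum] at h2
  linarith [hx i]

lemma compare {n m k : ℕ} (x : Fin n → Fin m → ℝ) (hx : ∀ i, ∑ c, x i c ^ 2 ≤ 1)
    (Q : Fin n → ℕ) (f : Fin n → Fin k) (J : Finset (Fin k))
    (hJ : ∀ i i', f i = f i' → f i ∉ J → Q i = Q i') :
    Real.sqrt (frob (res f x)) ≤ Real.sqrt (frob (res Q x)) +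
      4 * (univ.filter (fun i => f i ∈ J)).card := by
  set B := univ.filter (fun i => f i ∈ J) with hB
  set z := res f x with hz
  set w := res Q x with hw
  have e0 : frob z = ∑ i, ∑ j, (∑ a, z i a * z j a) ^ 2 := by
    rw [sum_cross]
    exact Finset.sum_congr rfl fun a _ => Finset.sum_congr rfl fun b _ => by ring
  have good : ∀ j, ∑ i, (if f i ∈ J then 0 else (∑ a, z i a * z j a) ^ 2) ≤
      ∑ i, (∑ a, w i a * z j a) ^ 2 := by
    intro j
    set h : Fin n → ℝ := fun i => if f i ∈ J then 0 else ∑ a, (w i a - z i a) * z j a with hh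
    have hconst : ∀ i i', f i = f i' → h i = h i' := by
      intro i i' hi
      simp only [hh, ← hi]
      by_cases hm : f i ∈ J
      · simp [hm]
      · simp only [hm, if_false]
        refine Finset.sum_congr rfl fun a _ => ?_
        simp only [hw, hz, res, avg_const f _ i i' hi, avg_const Q _ i i' (hJ i i' hi hm)]
        ring
    have horth : ∑ i, h i * ∑ a, z i a * z j a = 0 := by
      simp only [Finset.mul_sum]
      rw [Finset.sum_comm]
      refine Finset.sum_eq_zero fun a _ => ?_
      have := res_orth f x h hconst a
      rw [← hz] at this
      simp only [← mul_assoc]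
      rw [← Finset.sum_mul, this, zero_mul]
    have hle : ∑ i, ((if f i ∈ J then 0 else (∑ a, z i a * z j a) ^ 2)
        + 2 * (h i * ∑ a, z i a * z j a)) ≤ ∑ i, (∑ a, w i a * z j a) ^ 2 := by
      refine Finset.sum_le_sum fun i _ => ?_
      by_cases hm : f i ∈ J
      · simp only [hh, hm, if_true]
        nlinarith [sq_nonneg (∑ a, w i a * z j a)]
      · simp only [hh, hm, if_false, sub_mul, Finset.sum_sub_distrib]
        nlinarith [sq_nonneg (∑ a, w i a * z j a - ∑ a, z i a * z j a)]
    rw [Finset.sum_add_distrib, ← Finset.mul_sum, horth] at hle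
    linarith
  have h1 : ∑ i, ∑ j, (if f i ∈ J then 0 else (∑ a, z i a * z j a) ^ 2) ≤
      Real.sqrt (frob w) * Real.sqrt (frob z) := by
    rw [Finset.sum_comm]
    refine (Finset.sum_le_sum fun j _ => good j).trans ?_
    rw [Finset.sum_comm, sum_cross]
    exact cs_matrix _ _
  have h2 : ∑ i, ∑ j, (if f i ∈ J then (∑ a, z i a * z j a) ^ 2 else 0) ≤
      4 * B.card * Real.sqrt (frob z) := by
    have : ∀ i, ∑ j, (if f i ∈ J then (∑ a, z i a * z j a) ^ 2 else 0) ≤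
        if f i ∈ J then 4 * Real.sqrt (frob z) else 0 := by
      intro i
      by_cases hm : f i ∈ J
      · simp only [hm, if_true]
        refine (sum_inner_sq_le (z i) z).trans ?_
        gcongr
        exact res_norm x hx f i
      · simp [hm]
    refine (Finset.sum_le_sum fun i _ => this i).trans ?_
    rw [← Finset.sum_filter, Finset.sum_const, nsmul_eq_mul]
    apply le_of_eq; ring
  have h3 : frob z = ∑ i, ∑ j, (if f i ∈ J then 0 else (∑ a, z i a * z j a) ^ 2) +
      ∑ i, ∑ j, (if f i ∈ J then (∑ a, z i a * z j a) ^ 2 else 0) := by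
    rw [e0, ← Finset.sum_add_distrib]
    refine Finset.sum_congr rfl fun i _ => ?_
    rw [← Finset.sum_add_distrib]
    refine Finset.sum_congr rfl fun j _ => ?_
    by_cases hm : f i ∈ J <;> simp [hm]
  have h4 : Real.sqrt (frob z) ^ 2 = frob z := Real.sq_sqrt (frob_nonneg z)
  rcases eq_or_lt_of_le (Real.sqrt_nonneg (frob z)) with h5 | h5
  · rw [← h5]; exact add_nonneg (Real.sqrt_nonneg _) (mul_nonneg (by norm_num) (Nat.cast_nonneg _))
  · have : Real.sqrt (frob z) * Real.sqrt (frob z) ≤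
        (Real.sqrt (frob w) + 4 * B.card) * Real.sqrt (frob z) := by nlinarith
    exact le_of_mul_le_mul_right this h5

lemma cov_diff {n m k : ℕ} (x : Fin n → Fin m → ℝ) (f : Fin n → Fin k) (a b : Fin m) (μa μb : ℝ) :
    ∑ l, (x l a - μa) * (x l b - μb) -
      ∑ l, (avg f (fun l => x l a) l - μa) * (avg f (fun l => x l b) l - μb) =
    ∑ l, res f x l a * res f x l b := by
  have h1 := res_orth f x (fun l => avg f (fun l => x l a) l - μa)
    (fun i j h => congrArg (· - _) (avg_const f _ i j h)) b
  have h2 := res_orth f x (fun l => avg f (fun l => x l b) l - μb)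
    (fun i j h => congrArg (· - _) (avg_const f _ i j h)) a
  have : ∑ l, (x l a - μa) * (x l b - μb) = ∑ l, res f x l a * res f x l b +
      ∑ l, (avg f (fun l => x l a) l - μa) * (avg f (fun l => x l b) l - μb) +
      ∑ l, (avg f (fun l => x l a) l - μa) * res f x l b +
      ∑ l, (avg f (fun l => x l b) l - μb) * res f x l a := by
    simp only [← Finset.sum_add_distrib]
    refine Finset.sum_congr rfl fun l _ => ?_
    simp only [res]; ring
  rw [this, h1, h2]; ring

lemma mean_avg {n m k : ℕ} (x : Fin n → Fin m → ℝ) (f : Fin n → Fin k) (a : Fin m) :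
    ∑ l, avg f (fun l => x l a) l = ∑ l, x l a := by
  have := res_orth f x (fun _ => 1) (fun _ _ _ => rfl) a
  simp only [res, one_mul, Finset.sum_sub_distrib] at this
  linarith

lemma numeric (k n T c : ℕ) (hk : 3 ≤ k) (hkn : k ≤ n) (hT : T = Nat.log 4 k) (F : ℝ)
    (hF : F ≤ 4 * (n:ℝ) ^ 2 / (T + 1)) (hc : c ≤ 2 ^ T * (n / k + 1)) :
    (n:ℝ)⁻¹ * (Real.sqrt F + 4 * c) ≤ 12 / Real.sqrt (Real.log k) := by
  have hk' : (3:ℝ) ≤ k := by exact_mod_cast hk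
  have hkn' : (k:ℝ) ≤ n := by exact_mod_cast hkn
  have hn0 : (0:ℝ) < n := by linarith
  have hk0 : (0:ℝ) < k := by linarith
  have hlog : 0 < Real.log k := Real.log_pos (by linarith)
  set s := Real.sqrt (Real.log k) with hs
  have hs0 : 0 < s := Real.sqrt_pos.2 hlog
  have hs2 : s ^ 2 = Real.log k := Real.sq_sqrt hlog.le
  have hT1 : Real.log k ≤ (T + 1) * 4 := by
    have h1 : k < 4 ^ (T + 1) := by rw [hT]; exact Nat.lt_pow_succ_log_self (by norm_num) k
    have h2 : (k:ℝ) ≤ 4 ^ (T + 1) := by exact_mod_cast h1.le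
    have h3 := Real.log_le_log hk0 h2
    rw [Real.log_pow] at h3
    have h4 : Real.log 4 ≤ 4 := (Real.log_le_sub_one_of_pos (by norm_num)).trans (by norm_num)
    push_cast at h3
    nlinarith
  have hF2 : Real.sqrt F ≤ 4 * n / s := by
    apply Real.sqrt_le_iff.2
    refine ⟨by positivity, hF.trans ?_⟩
    rw [div_pow, hs2, div_le_div_iff₀ (by positivity) hlog]
    have := mul_le_mul_of_nonneg_left hT1 (by positivity : (0:ℝ) ≤ 4 * n ^ 2)
    nlinarith
  have hpow : (2:ℝ) ^ T * s ≤ k := by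
    have h1 : 4 ^ T ≤ k := by rw [hT]; exact Nat.pow_log_le_self 4 (by omega)
    have h2 : ((2:ℝ) ^ T) ^ 2 ≤ k := by
      rw [← pow_mul, mul_comm, pow_mul]; norm_num; exact_mod_cast h1
    have h3 : s ^ 2 ≤ k := by
      rw [hs2]; exact (Real.log_le_sub_one_of_pos hk0).trans (by linarith)
    nlinarith [sq_nonneg ((2:ℝ) ^ T - s)]
  have hc' : (c:ℝ) ≤ 2 * n / s := by
    have h1 : (c:ℝ) ≤ 2 ^ T * ((n / k : ℕ) + 1) := by exact_mod_cast hc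
    have h2 : ((n / k : ℕ) : ℝ) ≤ n / k := Nat.cast_div_le
    have h3 : (1:ℝ) ≤ n / k := by rw [le_div_iff₀ hk0]; linarith
    have h4 : (c:ℝ) ≤ 2 ^ T * (2 * (n / k)) :=
      h1.trans (mul_le_mul_of_nonneg_left (by linarith) (by positivity))
    refine h4.trans ?_
    rw [le_div_iff₀ hs0]
    calc 2 ^ T * (2 * ((n:ℝ) / k)) * s = (2 ^ T * s) * (2 * (n / k)) := by ring
      _ ≤ k * (2 * (n / k)) := by gcongr
      _ = 2 * n := by field_simp
  calc (n:ℝ)⁻¹ * (Real.sqrt F + 4 * c) ≤ (n:ℝ)⁻¹ * (4 * n / s + 4 * (2 * n / s)) := by gcongr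
    _ = 12 / s := by field_simp; norm_num

/-- **Accurate `⌊n/k⌋`-anonymous synthetic data.** There is an absolute constant `C > 0` such
that for any `x₁, …, x_n ∈ ℝ^m` with `‖xᵢ‖₂ ≤ 1` and any `3 ≤ k ≤ n` there is a partition
`[n] = I₁ ∪ ⋯ ∪ I_k` into `k` nonempty parts of size at least `⌊n/k⌋` such that, with `X`
uniform on the `xᵢ` and `Y` uniform on the corresponding part-averages `y_{I(i)}`, we have
`‖Σ_X - Σ_Y‖_F ≤ C / √(log k)`. -/
theorem anonymous_synthetic_data :
    ∃ C : ℝ, 0 < C ∧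
      ∀ (m n : ℕ) (x : Fin n → Fin m → ℝ),
        (∀ i, Real.sqrt (∑ j, x i j ^ 2) ≤ 1) →
        ∀ k : ℕ, 3 ≤ k → k ≤ n →
        ∃ f : Fin n → Fin k,
          (∀ j : Fin k, (Finset.univ.filter (fun i => f i = j)).Nonempty ∧
            n / k ≤ (Finset.univ.filter (fun i => f i = j)).card) ∧
          (let y : Fin n → Fin m → ℝ := fun i =>
              ((Finset.univ.filter (fun i' => f i' = f i)).card : ℝ)⁻¹ •
                ∑ i' ∈ Finset.univ.filter (fun i' => f i' = f i), x i'
           let mean : (Fin n → Fin m → ℝ) → Fin m → ℝ := fun v a => (n : ℝ)⁻¹ * ∑ l, v l a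
           let cov : (Fin n → Fin m → ℝ) → Matrix (Fin m) (Fin m) ℝ := fun v =>
             Matrix.of fun a b => (n : ℝ)⁻¹ * ∑ l, (v l a - mean v a) * (v l b - mean v b)
           Real.sqrt (∑ a, ∑ b, (cov x a b - cov y a b) ^ 2) ≤ C / Real.sqrt (Real.log k)) := by
  refine ⟨12, by norm_num, ?_⟩
  intro m n x hx k hk hkn
  have hx' : ∀ i, ∑ c, x i c ^ 2 ≤ 1 := fun i => by
    exact (Real.sqrt_le_one.1 (hx i))
  obtain ⟨Q, hQ, hF⟩ := exists_Q (by omega : 0 < n) x hx' (Nat.log 4 k)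
  obtain ⟨f, J, h1, h2, h3⟩ := exists_f n k _ (by omega) hkn Q hQ
  refine ⟨f, fun j => ⟨?_, h1 j⟩, ?_⟩
  · rw [← Finset.card_pos]
    exact lt_of_lt_of_le (Nat.div_pos hkn (by omega)) (h1 j)
  · intro y mean cov
    have hy : ∀ l a, y l a = avg f (fun l => x l a) l := by
      intro l a
      simp [y, avg]
    have hmean : ∀ a, mean y a = mean x a := by
      intro a
      simp only [mean, hy, mean_avg]
    have hcov : ∀ a b, cov x a b - cov y a b = (n:ℝ)⁻¹ * ∑ l, res f x l a * res f x l b := by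
      intro a b
      simp only [cov, Matrix.of_apply, hmean, hy]
      rw [← mul_sub, cov_diff]
    have hfr : Real.sqrt (∑ a, ∑ b, (cov x a b - cov y a b) ^ 2) =
        (n:ℝ)⁻¹ * Real.sqrt (frob (res f x)) := by
      simp only [hcov, mul_pow, ← Finset.mul_sum]
      rw [Real.sqrt_mul (by positivity), Real.sqrt_sq (by positivity)]
      rfl
    rw [hfr]
    refine le_trans ?_ (numeric k n _ _ hk hkn rfl _ hF h3)
    exact mul_le_mul_of_nonneg_left (compare x hx' Q f J h2) (by positivity)
end
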